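/- Let m ≥ 1 and for p = 1, …, m let A^p = (A^p_{ij})_{i,j=1}^s be a positive definite s×s block matrix over ℂ all of whose blocks A^p_{ij} are t_p × t_p matrices, and set σ_p := ( ∏_{q=1}^m t_q ) / t_p. For each i and p put r_{ip} := det(A^p_{ii}) · det (A^p)_{i−1} / det (A^p)_i (so r_{ip} ≥ 1 by Fischer's inequality). Then det(A^1 ∗ ⋯ ∗ A^m) ≥ ( ∏_{p=1}^m det(A^p)^{σ_p} ) · ∏_{i=1}^s ( ∏_{p=1}^m r_{ip}^{σ_p} − ∏_{p=1}^m ( r_{ip}^{σ_p} − 1 ) ). -/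

import Mathlib

open scoped ComplexOrder

/-- `prodLeadDet A k` is the determinant of the leading principal block
submatrix of the `s × s` block matrix `A` (with equal-sized blocks indexed by
`Fin s × β`) consisting of the first `k` block rows and columns (equal to `1`
when `k = 0`). -/
noncomputable def prodLeadDet {s : ℕ} {β : Type*} [Fintype β] [DecidableEq β]
    (A : Matrix (Fin s × β) (Fin s × β) ℂ) (k : ℕ) : ℂ :=
  (A.submatrix
    (fun x : {y : Fin s × β // (y.1 : ℕ) < k} => x.1)
    (fun x : {y : Fin s × β // (y.1 : ℕ) < k} => x.1)).det


open Matrix Finset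

theorem Matrix.IsHermitian.exists_unitary_diagonalization {n : Type*} [Fintype n] [DecidableEq n]
    {S : Matrix n n ℂ} (hS : S.IsHermitian) :
    ∃ U : Matrix n n ℂ, U * Uᴴ = 1 ∧
      S = U * diagonal (fun i => (hS.eigenvalues i : ℂ)) * Uᴴ := by
  refine ⟨hS.eigenvectorUnitary, Unitary.coe_mul_star_self _, ?_⟩
  have := hS.spectral_theorem
  rwa [Unitary.conjStarAlgAut_apply] at this

open scoped MatrixOrder in
theorem Matrix.PosDef.exists_simultaneous_diagonalization {n : Type*} [Fintype n] [DecidableEq n]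
    {S C : Matrix n n ℂ} (hS : S.PosDef) (hC : C.PosSemidef) :
    ∃ (W : Matrix n n ℂ) (c : n → ℝ), (∀ i, 0 ≤ c i) ∧ W * Wᴴ = S ∧
      W * diagonal (fun i => (c i : ℂ)) * Wᴴ = C := by
  obtain ⟨B, hB⟩ := CStarAlgebra.nonneg_iff_eq_star_mul_self.mp hS.posSemidef.nonneg
  rw [star_eq_conjTranspose] at hB
  have hBdet : IsUnit B.det := by
    have h : S.det ≠ 0 := hS.det_pos.ne'
    rw [hB, det_mul] at h
    exact isUnit_iff_ne_zero.mpr (right_ne_zero_of_mul h)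
  have hBdet' : IsUnit Bᴴ.det := by
    rw [det_conjTranspose]; exact hBdet.star
  have hZ : ((Bᴴ)⁻¹ * C * B⁻¹).PosSemidef := by
    have := hC.conjTranspose_mul_mul_same B⁻¹
    rwa [conjTranspose_nonsing_inv] at this
  obtain ⟨U, hU, hspec⟩ := hZ.1.exists_unitary_diagonalization
  refine ⟨Bᴴ * U, hZ.1.eigenvalues, hZ.eigenvalues_nonneg, ?_, ?_⟩
  · rw [conjTranspose_mul, conjTranspose_conjTranspose, Matrix.mul_assoc,
      ← Matrix.mul_assoc U, hU, Matrix.one_mul, hB]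
  · have h1 : Bᴴ * ((Bᴴ)⁻¹ * C * B⁻¹) * B = C := by
      rw [Matrix.mul_assoc, Matrix.mul_assoc, nonsing_inv_mul _ hBdet, Matrix.mul_one,
        ← Matrix.mul_assoc, mul_nonsing_inv _ hBdet', Matrix.one_mul]
    generalize hZ.1.eigenvalues = c at hspec
    rw [hspec] at h1
    rw [conjTranspose_mul, conjTranspose_conjTranspose, ← h1]
    simp only [Matrix.mul_assoc]

theorem Matrix.det_conj_diagonal {n : Type*} [Fintype n] [DecidableEq n]
    {S W : Matrix n n ℂ} (hW : W * Wᴴ = S) (d : n → ℂ) :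
    (W * diagonal d * Wᴴ).det = S.det * ∏ i, d i := by
  rw [det_mul, det_mul, det_diagonal, ← hW, det_mul]
  ring

theorem Matrix.PosDef.ofReal_det_re {n : Type*} [Fintype n] [DecidableEq n]
    {S : Matrix n n ℂ} (hS : S.PosDef) : ((S.det.re : ℝ) : ℂ) = S.det := by
  have := (Complex.lt_def.mp hS.det_pos).2
  apply Complex.ext <;> simp [← this]

theorem Matrix.PosDef.det_re_pos {n : Type*} [Fintype n] [DecidableEq n]
    {S : Matrix n n ℂ} (hS : S.PosDef) : 0 < S.det.re :=
  (Complex.lt_def.mp hS.det_pos).1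

theorem Matrix.PosDef.det_conj_diagonal_ofReal_re {n : Type*} [Fintype n] [DecidableEq n]
    {S W : Matrix n n ℂ} (hS : S.PosDef) (hW : W * Wᴴ = S) (d : n → ℝ) :
    (W * diagonal (fun i => (d i : ℂ)) * Wᴴ).det.re = S.det.re * ∏ i, d i := by
  rw [det_conj_diagonal hW, ← hS.ofReal_det_re, ← Complex.ofReal_prod, ← Complex.ofReal_mul,
    Complex.ofReal_re, Complex.ofReal_re]

theorem Matrix.conj_diagonal_one_add {n : Type*} [Fintype n] [DecidableEq n]
    (W : Matrix n n ℂ) (c : n → ℝ) :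
    W * diagonal (fun i => ((1 + c i : ℝ) : ℂ)) * Wᴴ =
      W * Wᴴ + W * diagonal (fun i => (c i : ℂ)) * Wᴴ := by
  have : (diagonal fun i => ((1 + c i : ℝ) : ℂ)) = 1 + diagonal fun i => (c i : ℂ) := by
    rw [← diagonal_one, diagonal_add]; simp
  rw [this, Matrix.mul_add, Matrix.add_mul, Matrix.mul_one]

theorem Matrix.PosDef.det_re_le_det_add_re {n : Type*} [Fintype n] [DecidableEq n]
    {S C : Matrix n n ℂ} (hS : S.PosDef) (hC : C.PosSemidef) :
    S.det.re ≤ (S + C).det.re := by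
  obtain ⟨W, c, hc, hW, hWC⟩ := hS.exists_simultaneous_diagonalization hC
  have h := conj_diagonal_one_add W c
  rw [hW, hWC] at h
  rw [← h, hS.det_conj_diagonal_ofReal_re hW]
  refine le_mul_of_one_le_right hS.det_re_pos.le ?_
  exact Finset.one_le_prod fun i => by simpa using hc i

theorem Fintype.prod_pi_apply {ι : Type*} [Fintype ι] [DecidableEq ι] {β : ι → Type*}
    [∀ p, Fintype (β p)] {R : Type*} [CommMonoid R] (p : ι) (g : β p → R) :
    ∏ J : (∀ q, β q), g (J p) = (∏ j, g j) ^ ∏ q ∈ univ.erase p, Fintype.card (β q) := by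
  classical
  rw [Fintype.prod_equiv (Equiv.piSplitAt p β) (fun J => g (J p)) (fun x => g x.1)
    (fun _ => rfl), Fintype.prod_prod_type]
  simp only [prod_const, prod_pow]
  congr 1
  rw [card_univ, Fintype.card_pi]
  exact (Finset.prod_subtype (univ.erase p) (fun q => by simp) fun q => Fintype.card (β q)).symm

/-- The Kronecker product of a finite family of matrices. -/
def piKronecker {ι : Type*} [Fintype ι] {α β : ι → Type*} {R : Type*} [CommMonoid R]
    (A : ∀ p, Matrix (α p) (β p) R) : Matrix (∀ p, α p) (∀ p, β p) R :=
  of fun x y => ∏ p, A p (x p) (y p)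

theorem piKronecker_mul {ι : Type*} [Fintype ι] [DecidableEq ι] {α β γ : ι → Type*}
    [∀ p, Fintype (β p)] {R : Type*} [CommSemiring R]
    (A : ∀ p, Matrix (α p) (β p) R) (B : ∀ p, Matrix (β p) (γ p) R) :
    piKronecker A * piKronecker B = piKronecker fun p => A p * B p := by
  ext x y
  simp only [piKronecker, mul_apply, of_apply]
  rw [Finset.prod_univ_sum, Fintype.piFinset_univ]
  simp only [prod_mul_distrib]

theorem piKronecker_conjTranspose {ι : Type*} [Fintype ι] {α β : ι → Type*}
    (A : ∀ p, Matrix (α p) (β p) ℂ) :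
    (piKronecker A)ᴴ = piKronecker fun p => (A p)ᴴ := by
  ext x y
  simp [piKronecker, conjTranspose_apply]

theorem piKronecker_diagonal {ι : Type*} [Fintype ι] {β : ι → Type*} [∀ p, DecidableEq (β p)]
    {R : Type*} [CommSemiring R] (d : ∀ p, β p → R) :
    piKronecker (fun p => diagonal (d p)) = diagonal fun x => ∏ p, d p (x p) := by
  ext x y
  simp only [piKronecker, of_apply, diagonal_apply]
  by_cases h : x = y
  · subst h; simp
  · rw [if_neg h]
    obtain ⟨p, hp⟩ := Function.ne_iff.mp h
    exact prod_eq_zero (mem_univ p) (if_neg hp)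

theorem piKronecker_one {ι : Type*} [Fintype ι] {β : ι → Type*} [∀ p, DecidableEq (β p)]
    {R : Type*} [CommSemiring R] :
    piKronecker (fun p => (1 : Matrix (β p) (β p) R)) = 1 := by
  simp_rw [← diagonal_one, piKronecker_diagonal, prod_const_one]

theorem piKronecker_conj_diagonal {ι : Type*} [Fintype ι] [DecidableEq ι] {β : ι → Type*}
    [∀ p, Fintype (β p)] [∀ p, DecidableEq (β p)] (W : ∀ p, Matrix (β p) (β p) ℂ)
    (d : ∀ p, β p → ℂ) :
    piKronecker (fun p => W p * diagonal (d p) * (W p)ᴴ) =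
      piKronecker W * diagonal (fun x => ∏ p, d p (x p)) * (piKronecker W)ᴴ := by
  rw [piKronecker_conjTranspose, ← piKronecker_diagonal, piKronecker_mul, piKronecker_mul]

theorem Matrix.IsHermitian.det_piKronecker {ι : Type*} [Fintype ι] [DecidableEq ι]
    {β : ι → Type*} [∀ p, Fintype (β p)] [∀ p, DecidableEq (β p)]
    {S : ∀ p, Matrix (β p) (β p) ℂ} (hS : ∀ p, (S p).IsHermitian) :
    (piKronecker S).det = ∏ p, (S p).det ^ ∏ q ∈ univ.erase p, Fintype.card (β q) := by
  choose U hU hspec using fun p => (hS p).exists_unitary_diagonalization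
  have hTU : piKronecker U * (piKronecker U)ᴴ = 1 := by
    rw [piKronecker_conjTranspose, piKronecker_mul, ← piKronecker_one]
    congr 1; funext p; exact hU p
  have hdet : ∀ p, (S p).det = ∏ i, ((hS p).eigenvalues i : ℂ) := fun p =>
    (hS p).det_eq_prod_eigenvalues
  have hT : piKronecker S = _ := (congrArg piKronecker (funext hspec)).trans
    (piKronecker_conj_diagonal U _)
  rw [hT, det_conj_diagonal hTU, det_one, one_mul, prod_comm]
  refine prod_congr rfl fun p _ => ?_
  rw [Fintype.prod_pi_apply p (fun i => ((hS p).eigenvalues i : ℂ)), hdet]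

theorem Finset.one_sub_prod_one_sub_mul_le {ι : Type*} (s : Finset ι) {q r : ι → ℝ}
    (hq0 : ∀ p, 0 ≤ q p) (hq1 : ∀ p, q p ≤ 1) (hr0 : ∀ p, 0 ≤ r p) (hr1 : ∀ p, r p ≤ 1) :
    1 - ∏ p ∈ s, (1 - q p * r p) ≤ (1 - ∏ p ∈ s, (1 - q p)) * (1 - ∏ p ∈ s, (1 - r p)) := by
  classical
  induction s using Finset.induction_on with
  | empty => simp
  | insert a s ha ih =>
    rw [prod_insert ha, prod_insert ha, prod_insert ha]
    have h1 : 0 ≤ ∏ p ∈ s, (1 - q p) := prod_nonneg fun p _ => by linarith [hq1 p]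
    have h2 : 0 ≤ ∏ p ∈ s, (1 - r p) := prod_nonneg fun p _ => by linarith [hr1 p]
    have h3 : ∏ p ∈ s, (1 - q p) ≤ 1 :=
      prod_le_one (fun p _ => by linarith [hq1 p]) fun p _ => by linarith [hq0 p]
    have h4 : ∏ p ∈ s, (1 - r p) ≤ 1 :=
      prod_le_one (fun p _ => by linarith [hr1 p]) fun p _ => by linarith [hr0 p]
    generalize ∏ p ∈ s, (1 - q p) = G at *
    generalize ∏ p ∈ s, (1 - r p) = H at *
    generalize ∏ p ∈ s, (1 - q p * r p) = K at *
    have hqr : 0 ≤ 1 - q a * r a := by nlinarith [hq0 a, hq1 a, hr0 a, hr1 a]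
    have e1 : 0 ≤ q a * (1 - r a) * ((1 - H) * G) :=
      mul_nonneg (mul_nonneg (hq0 a) (sub_nonneg.2 (hr1 a)))
        (mul_nonneg (sub_nonneg.2 h4) h1)
    have e2 : 0 ≤ (1 - q a) * r a * ((1 - G) * H) :=
      mul_nonneg (mul_nonneg (sub_nonneg.2 (hq1 a)) (hr0 a))
        (mul_nonneg (sub_nonneg.2 h3) h2)
    have := mul_le_mul_of_nonneg_left ih hqr
    linarith

theorem Finset.prod_sub_prod_sub_one_mul_le {ι : Type*} (s : Finset ι) {x y : ι → ℝ}
    (hx : ∀ p, 1 ≤ x p) (hy : ∀ p, 1 ≤ y p) :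
    ∏ p ∈ s, x p * y p - ∏ p ∈ s, (x p * y p - 1) ≤
      (∏ p ∈ s, x p - ∏ p ∈ s, (x p - 1)) * (∏ p ∈ s, y p - ∏ p ∈ s, (y p - 1)) := by
  have key : ∀ z : ι → ℝ, (∀ p, 1 ≤ z p) → ∏ p ∈ s, z p - ∏ p ∈ s, (z p - 1) =
      (∏ p ∈ s, z p) * (1 - ∏ p ∈ s, (1 - (z p)⁻¹)) := fun z hz => by
    rw [mul_sub, mul_one, ← prod_mul_distrib]
    congr 1
    refine prod_congr rfl fun p _ => ?_
    have : z p ≠ 0 := by linarith [hz p]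
    field_simp
  have h := s.one_sub_prod_one_sub_mul_le (q := fun p => (x p)⁻¹) (r := fun p => (y p)⁻¹)
    (fun p => inv_nonneg.2 (zero_le_one.trans (hx p))) (fun p => inv_le_one_of_one_le₀ (hx p))
    (fun p => inv_nonneg.2 (zero_le_one.trans (hy p))) (fun p => inv_le_one_of_one_le₀ (hy p))
  rw [key _ fun p => one_le_mul_of_one_le_of_one_le (hx p) (hy p), key x hx, key y hy,
    prod_mul_distrib]
  simp only [mul_inv]
  calc _ ≤ ((∏ p ∈ s, x p) * ∏ p ∈ s, y p) *
        ((1 - ∏ p ∈ s, (1 - (x p)⁻¹)) * (1 - ∏ p ∈ s, (1 - (y p)⁻¹))) := by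
        refine mul_le_mul_of_nonneg_left h (mul_nonneg ?_ ?_)
        · exact prod_nonneg fun p _ => zero_le_one.trans (hx p)
        · exact prod_nonneg fun p _ => zero_le_one.trans (hy p)
    _ = _ := by ring

theorem Finset.one_le_prod_sub_prod_sub_one {ι : Type*} [Fintype ι] [Nonempty ι] {x : ι → ℝ}
    (hx : ∀ p, 1 ≤ x p) : 1 ≤ ∏ p, x p - ∏ p, (x p - 1) := by
  obtain ⟨i⟩ := ‹Nonempty ι›
  have := prod_add_prod_le (s := univ) (f := x) (g := fun p => x p - 1) (h := fun _ => 1)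
    (mem_univ i) (by simp) (fun j _ _ => by simp) (fun j _ _ => hx j)
    (fun j _ => sub_nonneg.2 (hx j)) (fun _ _ => zero_le_one)
  simp only [prod_const_one] at this
  linarith

theorem Finset.prod_sub_prod_sub_one_prod_le {ι κ : Type*} [Fintype ι] [Nonempty ι]
    (s : Finset κ) {x : κ → ι → ℝ} (hx : ∀ j p, 1 ≤ x j p) :
    ∏ p, ∏ j ∈ s, x j p - ∏ p, (∏ j ∈ s, x j p - 1) ≤
      ∏ j ∈ s, (∏ p, x j p - ∏ p, (x j p - 1)) := by
  classical
  induction s using Finset.induction_on with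
  | empty => simp
  | insert a s ha ih =>
    simp only [prod_insert ha]
    refine (prod_sub_prod_sub_one_mul_le _ (hx a) fun p => ?_).trans ?_
    · exact Finset.prod_induction _ (fun z => (1 : ℝ) ≤ z)
        (fun _ _ => one_le_mul_of_one_le_of_one_le) le_rfl fun j _ => hx j p
    · exact mul_le_mul_of_nonneg_left ih
        (zero_le_one.trans (one_le_prod_sub_prod_sub_one (hx a)))

theorem piKronecker_add_sub_posDef_and_det_re_ge {ι : Type*} [Fintype ι] [DecidableEq ι]
    [Nonempty ι] {β : ι → Type*} [∀ p, Fintype (β p)] [∀ p, DecidableEq (β p)]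
    {S C : ∀ p, Matrix (β p) (β p) ℂ} (hS : ∀ p, (S p).PosDef) (hC : ∀ p, (C p).PosSemidef) :
    (piKronecker (fun p => S p + C p) - piKronecker C).PosDef ∧
    (∏ p, (S p).det.re ^ ∏ q ∈ univ.erase p, Fintype.card (β q)) *
      (∏ p, ((S p + C p).det.re / (S p).det.re) ^ (∏ q ∈ univ.erase p, Fintype.card (β q)) -
        ∏ p, (((S p + C p).det.re / (S p).det.re) ^
          (∏ q ∈ univ.erase p, Fintype.card (β q)) - 1)) ≤
      (piKronecker (fun p => S p + C p) - piKronecker C).det.re := by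
  choose W c hc hW hWC using fun p => (hS p).exists_simultaneous_diagonalization (hC p)
  have hSC : ∀ p, S p + C p = W p * diagonal (fun i => ((1 + c p i : ℝ) : ℂ)) * (W p)ᴴ :=
    fun p => by rw [conj_diagonal_one_add, hW, hWC]
  let d : (∀ p, β p) → ℝ := fun J => ∏ p, (1 + c p (J p)) - ∏ p, (1 + c p (J p) - 1)
  have hd : ∀ J, 1 ≤ d J := fun J =>
    one_le_prod_sub_prod_sub_one fun p => by linarith [hc p (J p)]
  have hT : piKronecker (fun p => S p + C p) - piKronecker C =
      piKronecker W * diagonal (fun J => (d J : ℂ)) * (piKronecker W)ᴴ := by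
    have h1 : piKronecker (fun p => S p + C p) = _ :=
      (congrArg piKronecker (funext hSC)).trans (piKronecker_conj_diagonal W _)
    have h2 : piKronecker C = _ :=
      (congrArg piKronecker (funext fun p => (hWC p).symm)).trans (piKronecker_conj_diagonal W _)
    rw [h1, h2, ← Matrix.sub_mul, ← Matrix.mul_sub, diagonal_sub]
    simp [d]
  have hWS : piKronecker W * (piKronecker W)ᴴ = piKronecker S := by
    rw [piKronecker_conjTranspose, piKronecker_mul]
    congr 1; funext p; exact hW p
  have hdetS : (piKronecker S).det =
      ((∏ p, (S p).det.re ^ ∏ q ∈ univ.erase p, Fintype.card (β q) : ℝ) : ℂ) := by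
    rw [IsHermitian.det_piKronecker fun p => (hS p).1, Complex.ofReal_prod]
    refine prod_congr rfl fun p _ => ?_
    rw [Complex.ofReal_pow, (hS p).ofReal_det_re]
  have hpos : 0 < ∏ p, (S p).det.re ^ ∏ q ∈ univ.erase p, Fintype.card (β q) :=
    prod_pos fun p _ => pow_pos (hS p).det_re_pos _
  have hdet : (piKronecker (fun p => S p + C p) - piKronecker C).det =
      (((∏ p, (S p).det.re ^ ∏ q ∈ univ.erase p, Fintype.card (β q)) * ∏ J, d J : ℝ) : ℂ) := by
    rw [hT, det_conj_diagonal hWS, hdetS]; push_cast; rfl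
  have hratio : ∀ p, (S p + C p).det.re / (S p).det.re = ∏ j, (1 + c p j) := fun p => by
    rw [hSC, (hS p).det_conj_diagonal_ofReal_re (hW p), mul_div_cancel_left₀]
    exact (hS p).det_re_pos.ne'
  constructor
  · rw [PosSemidef.posDef_iff_det_ne_zero, hdet]
    · exact Complex.ofReal_ne_zero.2
        (mul_pos hpos (prod_pos fun J _ => zero_lt_one.trans_le (hd J))).ne'
    · rw [hT]
      refine PosSemidef.mul_mul_conjTranspose_same (PosSemidef.diagonal fun J => ?_) _
      exact Complex.zero_le_real.2 (zero_le_one.trans (hd J))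
  · rw [hdet, Complex.ofReal_re]
    refine mul_le_mul_of_nonneg_left ?_ hpos.le
    have := prod_sub_prod_sub_one_prod_le univ (x := fun (J : ∀ p, β p) p => 1 + c p (J p))
      fun J p => by linarith [hc p (J p)]
    simp only [Fintype.prod_pi_apply _ fun j => 1 + c _ j] at this
    simpa only [hratio] using this

theorem Matrix.PosSemidef.prod_hadamard {ι : Type*} (s : Finset ι) {n : Type*} [Fintype n]
    {A : ι → Matrix n n ℂ} (hA : ∀ p, (A p).PosSemidef) :
    (of fun x y => ∏ p ∈ s, A p x y).PosSemidef := by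
  classical
  induction s using Finset.induction_on with
  | empty =>
    have := posSemidef_vecMulVec_self_star (fun _ : n => (1 : ℂ))
    convert this using 1
    ext; simp [vecMulVec]
  | insert a s ha ih =>
    have h : (of fun x y => ∏ p ∈ insert a s, A p x y) = A a ⊙ of fun x y => ∏ p ∈ s, A p x y := by
      ext x y
      simp [prod_insert ha]
    rw [h]
    exact (hA a).hadamard ih

theorem Matrix.PosSemidef.khatriRao {ι : Type*} [Fintype ι] {n : Type*} [Fintype n]
    {α : ι → Type*} {A : ∀ p, Matrix (α p) (α p) ℂ}
    (hA : ∀ p, (A p).PosSemidef) (f : ∀ p, n → α p) :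
    (of fun x y => ∏ p, A p (f p x) (f p y)).PosSemidef :=
  prod_hadamard univ fun p => (hA p).submatrix (f p)

theorem Matrix.PosDef.schur_complement {m n : Type*} [Fintype m] [DecidableEq m] [Fintype n]
    [DecidableEq n] {P : Matrix m m ℂ} {B : Matrix m n ℂ} {D : Matrix n n ℂ}
    (h : (fromBlocks P B Bᴴ D).PosDef) :
    P.PosDef ∧ (D - Bᴴ * P⁻¹ * B).PosDef ∧
      (fromBlocks P B Bᴴ D).det.re = P.det.re * (D - Bᴴ * P⁻¹ * B).det.re := by
  have hP : P.PosDef := h.submatrix (e := Sum.inl) Sum.inl_injective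
  let _ := hP.isUnit.invertible
  have hdet := det_fromBlocks₁₁ P B Bᴴ D
  rw [invOf_eq_nonsing_inv] at hdet
  have hS : (D - Bᴴ * P⁻¹ * B).PosDef := by
    rw [((PosDef.fromBlocks₁₁ B D hP).1 h.posSemidef).posDef_iff_det_ne_zero]
    have := h.det_pos.ne'
    rw [hdet] at this
    exact right_ne_zero_of_mul this
  refine ⟨hP, hS, ?_⟩
  rw [hdet, ← hP.ofReal_det_re, ← hS.ofReal_det_re, ← Complex.ofReal_mul]
  simp

theorem khatriRao_schur_step {ι : Type*} [Fintype ι] [DecidableEq ι] [Nonempty ι]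
    {β : ι → Type*} [∀ p, Fintype (β p)] [∀ p, DecidableEq (β p)]
    {α : ι → Type*} [∀ p, Fintype (α p)] [∀ p, DecidableEq (α p)]
    {n : Type*} [Fintype n] [DecidableEq n] (f : ∀ p, n → α p)
    {P : ∀ p, Matrix (α p) (α p) ℂ} {B : ∀ p, Matrix (α p) (β p) ℂ}
    {D : ∀ p, Matrix (β p) (β p) ℂ} (h : ∀ p, (fromBlocks (P p) (B p) (B p)ᴴ (D p)).PosDef)
    {Q : Matrix n n ℂ} (hQ : Q = of fun x y => ∏ p, P p (f p x) (f p y))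
    {N : Matrix n (∀ p, β p) ℂ} (hN : N = of fun x y => ∏ p, B p (f p x) (y p))
    (hdetQ : 0 < Q.det.re) {G L : ι → ℝ}
    (hL : ∀ p, L p = (P p).det.re)
    (hG : ∀ p, G p = (fromBlocks (P p) (B p) (B p)ᴴ (D p)).det.re) :
    let b := (∏ p, (G p / L p) ^ ∏ q ∈ univ.erase p, Fintype.card (β q)) *
      (∏ p, ((D p).det.re * L p / G p) ^ (∏ q ∈ univ.erase p, Fintype.card (β q)) -
        ∏ p, (((D p).det.re * L p / G p) ^
          (∏ q ∈ univ.erase p, Fintype.card (β q)) - 1))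
    0 < b ∧ b * Q.det.re ≤ (fromBlocks Q N Nᴴ (piKronecker D)).det.re := by
  choose hP hS hdet using fun p => (h p).schur_complement
  let C : ∀ p, Matrix (β p) (β p) ℂ := fun p => (B p)ᴴ * (P p)⁻¹ * B p
  let S : ∀ p, Matrix (β p) (β p) ℂ := fun p => D p - C p
  have hC : ∀ p, (C p).PosSemidef := fun p =>
    (hP p).inv.posSemidef.conjTranspose_mul_mul_same (B p)
  have hSC : ∀ p, S p + C p = D p := fun p => sub_add_cancel _ _
  have hLp : ∀ p, 0 < L p := fun p => hL p ▸ (hP p).det_re_pos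
  have hSp : ∀ p, 0 < (S p).det.re := fun p => (hS p).det_re_pos
  have hGS : ∀ p, G p / L p = (S p).det.re := fun p => by
    rw [hG, hdet, ← hL, mul_div_cancel_left₀ _ (hLp p).ne']
  have hr : ∀ p, (D p).det.re * L p / G p = (S p + C p).det.re / (S p).det.re := fun p => by
    rw [hSC, ← hGS, div_div_eq_mul_div]
  have hQpsd : Q.PosSemidef := by
    rw [hQ]; exact PosSemidef.khatriRao (fun p => (hP p).posSemidef) f
  have hQpd : Q.PosDef := by
    rw [hQpsd.posDef_iff_det_ne_zero]
    intro h0; simp [h0] at hdetQ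
  let _ := hQpd.isUnit.invertible
  let _ := fun p => (hP p).isUnit.invertible
  obtain ⟨hpd, hge⟩ := piKronecker_add_sub_posDef_and_det_re_ge (S := S) (C := C) hS hC
  have hNC : (piKronecker C - Nᴴ * Q⁻¹ * N).PosSemidef := by
    rw [← PosDef.fromBlocks₁₁ N _ hQpd]
    have hblk : ∀ p, (fromBlocks (P p) (B p) (B p)ᴴ (C p)).PosSemidef := fun p => by
      rw [PosDef.fromBlocks₁₁ (B p) _ (hP p), sub_self]
      exact PosSemidef.zero
    have heq : fromBlocks Q N Nᴴ (piKronecker C) = of fun x y =>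
        ∏ p, fromBlocks (P p) (B p) (B p)ᴴ (C p)
          (Sum.map (f p) (fun y : ∀ p, β p => y p) x)
          (Sum.map (f p) (fun y : ∀ p, β p => y p) y) := by
      ext (x | x) (y | y) <;> simp [hQ, hN, piKronecker]
    rw [heq]
    exact PosSemidef.khatriRao hblk fun p => Sum.map (f p) (fun y : ∀ p, β p => y p)
  have hsum : piKronecker D - Nᴴ * Q⁻¹ * N =
      (piKronecker (fun p => S p + C p) - piKronecker C) +
        (piKronecker C - Nᴴ * Q⁻¹ * N) := by
    simp only [hSC]; abel
  have hT : (piKronecker D - Nᴴ * Q⁻¹ * N).PosDef := hsum ▸ hpd.add_posSemidef hNC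
  have hmono := hpd.det_re_le_det_add_re hNC
  rw [← hsum] at hmono
  have hdetM : (fromBlocks Q N Nᴴ (piKronecker D)).det.re =
      (piKronecker D - Nᴴ * Q⁻¹ * N).det.re * Q.det.re := by
    rw [det_fromBlocks₁₁, invOf_eq_nonsing_inv, ← hQpd.ofReal_det_re, ← hT.ofReal_det_re,
      ← Complex.ofReal_mul]
    simp [mul_comm]
  intro b
  constructor
  · refine mul_pos (prod_pos fun p _ => pow_pos (hGS p ▸ hSp p) _)
      (zero_lt_one.trans_le (one_le_prod_sub_prod_sub_one fun p => one_le_pow₀ ?_))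
    rw [hr, one_le_div (hSp p)]
    exact (hS p).det_re_le_det_add_re (hC p)
  · rw [hdetM]
    refine mul_le_mul_of_nonneg_right (le_trans (le_of_eq ?_) (hge.trans hmono)) hdetQ.le
    simp only [b, hr, hGS]

theorem Fin.prod_le_of_mul_le_succ {s : ℕ} {b : Fin s → ℝ} {L : ℕ → ℝ} (h0 : L 0 = 1)
    (h : ∀ i : Fin s, 0 < L i → 0 < b i ∧ b i * L i ≤ L (i + 1)) :
    0 < ∏ i, b i ∧ ∏ i, b i ≤ L s := by
  induction s with
  | zero => simp [h0]
  | succ s ih =>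
    obtain ⟨h1, h2⟩ := ih (b := fun i => b i.castSucc) fun i => h i.castSucc
    obtain ⟨h3, h4⟩ := h (Fin.last s) (h1.trans_le h2)
    rw [Fin.prod_univ_castSucc]
    exact ⟨mul_pos h1 h3, ((mul_comm _ _).trans_le (mul_le_mul_of_nonneg_left h2 h3.le)).trans h4⟩

/-- The inclusion of the first `k` block indices together with the `k`-th one. -/
def leadSuccIndex {s : ℕ} (β : Type*) (k : Fin s) :
    {y : Fin s × β // (y.1 : ℕ) < k} ⊕ β → Fin s × β :=
  Sum.elim Subtype.val fun b => (k, b)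

theorem leadSuccIndex_injective {s : ℕ} (β : Type*) (k : Fin s) :
    Function.Injective (leadSuccIndex β k) := by
  rintro (⟨⟨i, x⟩, hx⟩ | x) (⟨⟨j, y⟩, hy⟩ | y) hxy <;>
    simp only [leadSuccIndex, Sum.elim_inl, Sum.elim_inr, Prod.mk.injEq] at hxy
  · obtain ⟨rfl, rfl⟩ := hxy; rfl
  · obtain ⟨rfl, rfl⟩ := hxy; simp at hx
  · obtain ⟨rfl, rfl⟩ := hxy; simp at hy
  · rw [hxy.2]

theorem prodLeadDet_succ {s : ℕ} {β : Type*} [Fintype β] [DecidableEq β]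
    (A : Matrix (Fin s × β) (Fin s × β) ℂ) (k : Fin s) :
    prodLeadDet A (k + 1) = (A.submatrix (leadSuccIndex β k) (leadSuccIndex β k)).det := by
  have hlt : ∀ z, ((leadSuccIndex β k z).1 : ℕ) < k + 1 := by
    rintro (⟨y, hy⟩ | y)
    · exact hy.trans (Nat.lt_succ_self _)
    · exact Nat.lt_succ_self _
  let e : {y : Fin s × β // (y.1 : ℕ) < k} ⊕ β → {y : Fin s × β // (y.1 : ℕ) < k + 1} :=
    fun z => ⟨leadSuccIndex β k z, hlt z⟩
  have he : Function.Bijective e := by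
    constructor
    · intro x y hxy
      exact leadSuccIndex_injective β k (congrArg Subtype.val hxy)
    · rintro ⟨⟨i, x⟩, hx⟩
      rcases (Nat.lt_succ_iff_lt_or_eq.1 hx) with h | h
      · exact ⟨Sum.inl ⟨(i, x), h⟩, rfl⟩
      · obtain rfl : i = k := Fin.ext h
        exact ⟨Sum.inr x, rfl⟩
  rw [prodLeadDet, ← det_submatrix_equiv_self (Equiv.ofBijective e he), submatrix_submatrix]
  rfl

theorem prodLeadDet_zero {s : ℕ} {β : Type*} [Fintype β] [DecidableEq β]
    (A : Matrix (Fin s × β) (Fin s × β) ℂ) : prodLeadDet A 0 = 1 := by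
  have : IsEmpty {y : Fin s × β // (y.1 : ℕ) < 0} := ⟨fun y => Nat.not_lt_zero _ y.2⟩
  exact det_isEmpty

theorem prodLeadDet_self {s : ℕ} {β : Type*} [Fintype β] [DecidableEq β]
    (A : Matrix (Fin s × β) (Fin s × β) ℂ) : prodLeadDet A s = A.det :=
  det_submatrix_equiv_self (Equiv.subtypeUnivEquiv fun y : Fin s × β => y.1.2) A

theorem Matrix.PosDef.prodLeadDet_re_pos {s : ℕ} {β : Type*} [Fintype β] [DecidableEq β]
    {A : Matrix (Fin s × β) (Fin s × β) ℂ} (hA : A.PosDef) (k : ℕ) : 0 < (prodLeadDet A k).re :=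
  (hA.submatrix Subtype.val_injective).det_re_pos

theorem Matrix.PosDef.prod_prodLeadDet_div {s : ℕ} {β : Type*} [Fintype β] [DecidableEq β]
    {A : Matrix (Fin s × β) (Fin s × β) ℂ} (hA : A.PosDef) :
    ∏ i : Fin s, (prodLeadDet A (i + 1)).re / (prodLeadDet A i).re = A.det.re := by
  rw [Fin.prod_univ_eq_prod_range
    (fun i => (prodLeadDet A (i + 1)).re / (prodLeadDet A i).re) s]
  have : ∀ k, ∏ i ∈ range k, (prodLeadDet A (i + 1)).re / (prodLeadDet A i).re =
      (prodLeadDet A k).re := fun k => by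
    induction k with
    | zero => simp [prodLeadDet_zero]
    | succ k ih =>
      rw [prod_range_succ, ih, mul_div_cancel₀]
      exact (hA.prodLeadDet_re_pos k).ne'
  rw [this, prodLeadDet_self]

/-- Sharper Oppenheim–Schur-type lower bound for the Khatri–Rao product
`M = A¹ ∗ ⋯ ∗ Aᵐ` of positive definite `s × s` block matrices `Aᵖ` with blocks
of size `t p × t p` (`σ p = ∏_{q ≠ p} t q`); with (0-based)
`r i p = det(Aᵖᵢᵢ) · det (Aᵖ)_i / det (Aᵖ)_{i+1}`:
`det M ≥ (∏_p det(Aᵖ)^{σ_p}) · ∏_i (∏_p (r i p)^{σ_p} − ∏_p ((r i p)^{σ_p} − 1))`. -/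
theorem stmt_17 {m s : ℕ} (hm : 1 ≤ m) (t : Fin m → ℕ)
    (A : ∀ p : Fin m, Matrix (Fin s × Fin (t p)) (Fin s × Fin (t p)) ℂ)
    (hA : ∀ p, (A p).PosDef)
    (M : Matrix (Fin s × ∀ p, Fin (t p)) (Fin s × ∀ p, Fin (t p)) ℂ)
    (hM : ∀ x y, M x y = ∏ p, A p (x.1, x.2 p) (y.1, y.2 p)) :
    (∏ p, (A p).det.re ^ ∏ q ∈ Finset.univ.erase p, t q) *
      ∏ i : Fin s,
        ((∏ p, ((Matrix.of fun x y : Fin (t p) => A p (i, x) (i, y)).det.re *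
              (prodLeadDet (A p) (i : ℕ)).re /
              (prodLeadDet (A p) ((i : ℕ) + 1)).re)
            ^ ∏ q ∈ Finset.univ.erase p, t q) -
          ∏ p, (((Matrix.of fun x y : Fin (t p) => A p (i, x) (i, y)).det.re *
              (prodLeadDet (A p) (i : ℕ)).re /
              (prodLeadDet (A p) ((i : ℕ) + 1)).re)
            ^ (∏ q ∈ Finset.univ.erase p, t q) - 1))
      ≤ M.det.re := by
  have : Nonempty (Fin m) := ⟨⟨0, hm⟩⟩
  have hdet : ∏ p, (A p).det.re ^ ∏ q ∈ univ.erase p, t q = ∏ i : Fin s, ∏ p,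
      ((prodLeadDet (A p) (i + 1)).re / (prodLeadDet (A p) i).re) ^
        ∏ q ∈ univ.erase p, t q := by
    rw [prod_comm]
    refine prod_congr rfl fun p _ => ?_
    rw [prod_pow, (hA p).prod_prodLeadDet_div]
  rw [hdet, ← prod_mul_distrib, ← prodLeadDet_self M]
  refine (Fin.prod_le_of_mul_le_succ (L := fun k => (prodLeadDet M k).re)
    (by simp [prodLeadDet_zero]) fun k hk => ?_).2
  let H := fun p => (A p).submatrix (leadSuccIndex (Fin (t p)) k) (leadSuccIndex (Fin (t p)) k)
  have hH : ∀ p, (H p).PosDef := fun p => (hA p).submatrix (leadSuccIndex_injective _ k)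
  have hblk : ∀ p, fromBlocks (H p).toBlocks₁₁ (H p).toBlocks₁₂ (H p).toBlocks₁₂ᴴ
      (H p).toBlocks₂₂ = H p := fun p => by
    have : (H p).toBlocks₁₂ᴴ = (H p).toBlocks₂₁ := by
      ext x y
      exact (hH p).1.apply (Sum.inr x) (Sum.inl y)
    rw [this, fromBlocks_toBlocks]
  have hstep := khatriRao_schur_step
    (n := {y : Fin s × (∀ p, Fin (t p)) // (y.1 : ℕ) < k})
    (fun p x => (⟨(x.1.1, x.1.2 p), x.2⟩ : {y : Fin s × Fin (t p) // (y.1 : ℕ) < k}))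
    (P := fun p => (H p).toBlocks₁₁) (B := fun p => (H p).toBlocks₁₂)
    (D := fun p => (H p).toBlocks₂₂) (fun p => (hblk p).symm ▸ hH p)
    (Q := M.submatrix Subtype.val Subtype.val)
    (by ext x y; exact hM x.1 y.1)
    (N := M.submatrix Subtype.val (fun y => (k, y)))
    (by ext x y; exact hM x.1 (k, y))
    hk (L := fun p => (prodLeadDet (A p) k).re) (G := fun p => (prodLeadDet (A p) (k + 1)).re)
    (fun _ => rfl) (fun p => by rw [hblk, prodLeadDet_succ])
  simp only [Fintype.card_fin] at hstep
  refine ⟨hstep.1, hstep.2.trans (le_of_eq ?_)⟩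
  rw [prodLeadDet_succ]
  congr 2
  ext (x | x) (y | y)
  · rfl
  · rfl
  · simp only [fromBlocks_apply₂₁, conjTranspose_apply, submatrix_apply, leadSuccIndex,
      Sum.elim_inl, Sum.elim_inr, hM, star_prod]
    exact prod_congr rfl fun p _ => (hA p).1.apply _ _
  · exact (hM (k, x) (k, y)).symm
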